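/- arXiv:1403.3736 — 3 statements merged into one kernel-verified Lean document; each statement's English description precedes it below -/
import Mathlib

section
/- For every multigraph H (no loops), the homomorphism density function t(H,−) : W → ℝ is Gâteaux smooth. Its Gâteaux derivatives d^n t(H,·)(f; g₁, …, g_n) vanish identically whenever n > |E(H)|, and for n ≤ |E(H)| they are given by d^n t(H,·)(f; g₁, …, g_n) = Σ_{A ⊆ E(H), |A| = n} Σ_{σ : {1,…,n} → A bijective} ∫_{[0,1]^{V(H)}} ∏_{l=1}^n g_l(x_{σ(l)_s}, x_{σ(l)_t}) · ∏_{e ∈ E(H)∖A} f(x_{e_s}, x_{e_t}) ∏_{i∈V(H)} dx_i. -/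
open MeasureTheory Filter Set Topology
open scoped BigOperators Classical ENNReal

noncomputable section

/-- The type of kernels: functions `[0,1]² → ℝ` (formalized as functions on all of `ℝ²`). -/
abbrev Kern : Type := ℝ → ℝ → ℝ

/-- Lebesgue measure restricted to `[0,1]`. -/
abbrev μ01 : Measure ℝ := volume.restrict (Set.Icc 0 1)

/-- Symmetric measurable function. -/
def IsSymmMeas (f : Kern) : Prop :=
  Measurable (Function.uncurry f) ∧ ∀ x y, f x y = f y x

/-- Membership in the space `𝒲` of bounded symmetric measurable functions. -/
def IsKernel (f : Kern) : Prop := IsSymmMeas f ∧ ∃ C : ℝ, ∀ x y, |f x y| ≤ C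

/-- A graphon: a symmetric measurable function with values in `[0,1]`. -/
def IsGraphon (f : Kern) : Prop := IsSymmMeas f ∧ ∀ x y, f x y ∈ Set.Icc (0:ℝ) 1

/-- The set `W` of graphons. -/
def Graphons : Set Kern := {f | IsGraphon f}

/-- A multigraph (no loops, multiple edges allowed), with vertex set `Fin nv` and
edge (multi)set indexed by `Fin ne`, the edge `e` having endpoints `s e`, `t e`. -/
structure MG where
  nv : ℕ
  ne : ℕ
  s : Fin ne → Fin nv
  t : Fin ne → Fin nv
  noLoop : ∀ e, s e ≠ t e

/-- The homomorphism density `t(G, f)` of a multigraph `G` in a kernel `f`. -/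
def homDensity (G : MG) (f : Kern) : ℝ :=
  ∫ x : Fin G.nv → ℝ, ∏ e : Fin G.ne, f (x (G.s e)) (x (G.t e))
    ∂(Measure.pi fun _ => μ01)

/-- A node-and-edge homomorphism of multigraphs. -/
structure MGHom (G H : MG) where
  vMap : Fin G.nv → Fin H.nv
  eMap : Fin G.ne → Fin H.ne
  compat : ∀ e, ({H.s (eMap e), H.t (eMap e)} : Finset (Fin H.nv))
      = {vMap (G.s e), vMap (G.t e)}

/-- A surjective node-and-edge homomorphism. -/
def MGHom.Surj {G H : MG} (φ : MGHom G H) : Prop :=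
  Function.Surjective φ.vMap ∧ Function.Surjective φ.eMap

/-- A bijective node-and-edge homomorphism. -/
def MGHom.Bij {G H : MG} (φ : MGHom G H) : Prop :=
  Function.Bijective φ.vMap ∧ Function.Bijective φ.eMap

instance (G H : MG) : Finite (MGHom G H) := by
  have hinj : Function.Injective (fun φ : MGHom G H => (φ.vMap, φ.eMap)) := by
    rintro ⟨v1, e1, h1⟩ ⟨v2, e2, h2⟩ h
    simp only [Prod.mk.injEq] at h
    obtain ⟨hv, he⟩ := h
    subst hv; subst he; rfl
  exact Finite.of_injective _ hinj

/-- Isomorphism of multigraphs. -/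
def MGIso (G H : MG) : Prop := ∃ φ : MGHom G H, φ.Bij

/-- A multigraph with no isolated vertices. -/
def NoIsolated (G : MG) : Prop := ∀ v, ∃ e, G.s e = v ∨ G.t e = v

/-- A multigraph is simple if no two (distinct) edges have the same pair of endpoints. -/
def IsSimpleMG (G : MG) : Prop :=
  ∀ e e', ({G.s e, G.t e} : Finset (Fin G.nv)) = ({G.s e', G.t e'} : Finset (Fin G.nv))
    → e = e'

/-- A class function on graphon space: it only depends on the homomorphism densities
with respect to finite simple graphs. -/
def IsClassFun (F : Kern → ℝ) : Prop :=
  ∀ f g, IsGraphon f → IsGraphon g →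
    (∀ G : MG, IsSimpleMG G → homDensity G f = homDensity G g) → F f = F g

/-- The `L¹` distance between two kernels (on the square `[0,1]²`). -/
def l1Dist (f g : Kern) : ℝ := ∫ x, ∫ y, |f x y - g x y| ∂μ01 ∂μ01

/-- Continuity on the set of graphons with respect to the `L¹` norm. -/
def L1ContOn (F : Kern → ℝ) : Prop :=
  ∀ f ∈ Graphons, ∀ ε : ℝ, 0 < ε → ∃ δ : ℝ, 0 < δ ∧
    ∀ g ∈ Graphons, l1Dist f g < δ → |F f - F g| < ε

/-- The cut norm of a kernel. -/
def cutNorm (f : Kern) : ℝ :=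
  sSup {r : ℝ | ∃ S T : Set ℝ, MeasurableSet S ∧ MeasurableSet T ∧
    S ⊆ Set.Icc 0 1 ∧ T ⊆ Set.Icc 0 1 ∧ r = |∫ x in S, ∫ y in T, f x y|}

/-- Continuity on the set of graphons with respect to the cut norm. -/
def CutContOn (F : Kern → ℝ) : Prop :=
  ∀ f ∈ Graphons, ∀ ε : ℝ, 0 < ε → ∃ δ : ℝ, 0 < δ ∧
    ∀ g ∈ Graphons, cutNorm (f - g) < δ → |F f - F g| < ε

section Gateaux

variable {E : Type*} [AddCommGroup E] [Module ℝ E]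

/-- Admissible directions at `f` for a convex subset `U` of a real vector space:
directions `g` so that `f + ε g ∈ U` for all sufficiently small `ε ∈ [0,1)`. -/
def adm (U : Set E) (f : E) : Set E :=
  {g | ∃ ε₀ : ℝ, 0 < ε₀ ∧ ε₀ ≤ 1 ∧ ∀ ε : ℝ, 0 ≤ ε → ε < ε₀ → f + ε • g ∈ U}

/-- Iterated mixed Gâteaux derivative `d^n F(f; g₁, …, g_n)` of `F : U → ℝ`, computed
through one-sided difference quotients restricted to `U`; the derivative in the last
direction is taken first.  (The value is given by `Filter.limUnder`, i.e. it is the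
limit of the difference quotients whenever this limit exists.) -/
def gD (U : Set E) (F : E → ℝ) : (n : ℕ) → E → (Fin n → E) → ℝ
  | 0 => fun f _ => F f
  | n + 1 => fun f g =>
      limUnder (nhdsWithin (0:ℝ) {t : ℝ | t ≠ 0 ∧ f + t • g (Fin.last n) ∈ U})
        (fun t => (gD U F n (f + t • g (Fin.last n)) (fun i => g i.castSucc)
              - gD U F n f (fun i => g i.castSucc)) / t)

/-- `F` is `n` times Gâteaux differentiable on `U`: all iterated Gâteaux derivatives
up to order `n` in admissible directions exist (i.e. the corresponding difference
quotients genuinely converge). -/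
def GDiffN (U : Set E) (F : E → ℝ) : ℕ → Prop
  | 0 => True
  | n + 1 => GDiffN U F n ∧
      ∀ f ∈ U, ∀ g : Fin (n+1) → E, (∀ i, g i ∈ adm U f) →
        Tendsto
          (fun t : ℝ => (gD U F n (f + t • g (Fin.last n)) (fun i => g i.castSucc)
              - gD U F n f (fun i => g i.castSucc)) / t)
          (nhdsWithin (0:ℝ) {t : ℝ | t ≠ 0 ∧ f + t • g (Fin.last n) ∈ U})
          (nhds (gD U F (n+1) f g))

/-- `F : U → ℝ` is `C^n` at `f`: for any admissible directions `g₁, …, g_m`, the map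
`(λ₁, …, λ_m) ↦ F(f + Σᵢ λᵢ gᵢ)` admits a `C^n` extension to all of `ℝ^m`. -/
def IsCnAt (U : Set E) (F : E → ℝ) (n : ℕ) (f : E) : Prop :=
  ∀ (m : ℕ) (g : Fin m → E), (∀ i, g i ∈ adm U f) →
    ∃ G : (Fin m → ℝ) → ℝ, ContDiff ℝ n G ∧
      ∀ lam : Fin m → ℝ, f + ∑ i, lam i • g i ∈ U → G lam = F (f + ∑ i, lam i • g i)

/-- `F` is `C^n` (everywhere on `U`). -/
def IsCn (U : Set E) (F : E → ℝ) (n : ℕ) : Prop := ∀ f ∈ U, IsCnAt U F n f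

/-- `F` is Gâteaux smooth: `C^n` at every point for every `n`. -/
def GSmooth (U : Set E) (F : E → ℝ) : Prop := ∀ n : ℕ, IsCn U F n

end Gateaux

/-- Iso-invariance of a family of constants indexed by multigraphs. -/
def IsoInvariant (a : MG → ℝ) : Prop := ∀ G H, MGIso G H → a G = a H

/-- Coefficients indexed by the isomorphism classes of multigraphs with at most `N`
edges and no isolated vertices (encoded as iso-invariant families of constants
vanishing outside this class of multigraphs). -/
def GoodCoeffs (N : ℕ) (a : MG → ℝ) : Prop :=
  IsoInvariant a ∧ ∀ G : MG, ¬(G.ne ≤ N ∧ NoIsolated G) → a G = 0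

/-- A functional on `W^n` is multilinear if its restriction to tuples from the
subspace `𝒲` (= span of `W`) is linear in each coordinate. -/
def MultilinearOnKerns (n : ℕ) (Λ : (Fin n → Kern) → ℝ) : Prop :=
  (∀ (g : Fin n → Kern), (∀ j, IsKernel (g j)) → ∀ (i : Fin n) (u v : Kern),
      IsKernel u → IsKernel v →
      Λ (Function.update g i (u + v))
        = Λ (Function.update g i u) + Λ (Function.update g i v)) ∧
  (∀ (g : Fin n → Kern), (∀ j, IsKernel (g j)) → ∀ (i : Fin n) (c : ℝ) (u : Kern),
      IsKernel u →
      Λ (Function.update g i (c • u)) = c * Λ (Function.update g i u))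

/-- A functional on `W^n` extends to a multilinear functional on `(span ℝ W)^n`. -/
def IsMultilinearOnW (n : ℕ) (Λ : (Fin n → Kern) → ℝ) : Prop :=
  ∃ L : MultilinearMap ℝ (fun _ : Fin n => ↥(Submodule.span ℝ Graphons)) ℝ,
    ∀ (g : Fin n → Kern) (h : ∀ i, g i ∈ Graphons),
      L (fun i => ⟨g i, Submodule.subset_span (h i)⟩) = Λ g

/-- An invertible Lebesgue-measure-preserving bijection of `[0,1]`. -/
def IsMPB (σ : ℝ → ℝ) : Prop :=
  MeasurePreserving σ μ01 μ01 ∧ Set.BijOn σ (Set.Icc 0 1) (Set.Icc 0 1)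

/-- The action `f ↦ f^σ` of maps of `[0,1]` on kernels. -/
def Kern.translate (σ : ℝ → ℝ) (f : Kern) : Kern := fun x y => f (σ x) (σ y)

/-- The cell `((a)/p, (a+1)/p]` of the regular partition of `[0,1]` (`a = 0, …, p-1`). -/
def cell (p : ℕ) (a : Fin p) : Set ℝ :=
  Set.Ioc (((a : ℕ) : ℝ) / (p : ℝ)) ((((a : ℕ) : ℝ) + 1) / (p : ℝ))

/-- The basic step graphon `e^p_(a,b)`: symmetrized indicator of `cell a × cell b`. -/
def ep (p : ℕ) (a b : Fin p) : Kern := fun x y =>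
  if (x ∈ cell p a ∧ y ∈ cell p b) ∨ (x ∈ cell p b ∧ y ∈ cell p a) then 1 else 0

/-- The step kernel with values `c a b` on the cell `cell a × cell b` (`a ≠ b`) and `0`
on the diagonal cells and outside `(0,1]²`. -/
def stepFn (p : ℕ) (c : Fin p → Fin p → ℝ) : Kern := fun x y =>
  ∑ a : Fin p, ∑ b : Fin p, if a ≠ b ∧ x ∈ cell p a ∧ y ∈ cell p b then c a b else 0

/-- The set `W_𝐩 = ⋃ₚ W_p` of step graphons. -/
def StepGraphons : Set Kern := {f | IsGraphon f ∧ ∃ p c, f = stepFn p c}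

/-- The union of the `S_[0,1]`-translates of `W_𝐩`. -/
def StepTranslates : Set Kern :=
  {f | ∃ σ : ℝ → ℝ, IsMPB σ ∧ ∃ g ∈ StepGraphons, f = Kern.translate σ g}

/-- Add `m` isolated vertices to a multigraph. -/
def MG.pad (G : MG) (m : ℕ) : MG where
  nv := G.nv + m
  ne := G.ne
  s := fun e => Fin.castAdd m (G.s e)
  t := fun e => Fin.castAdd m (G.t e)
  noLoop := fun e h => G.noLoop e (by
    apply Fin.ext
    simpa using congrArg Fin.val h)

/-- Two multigraphs become isomorphic after deleting isolated vertices (equivalently,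
after adding enough isolated vertices). -/
def StripEquiv (G H : MG) : Prop := ∃ a b : ℕ, MGIso (G.pad a) (H.pad b)

/-- A tuple of pairs of distinct indices in `Fin p` (encoding a tuple in `E_p^n`). -/
def ValidTuple (p n : ℕ) (x : Fin n → Fin p × Fin p) : Prop := ∀ l, (x l).1 ≠ (x l).2

/-- The multigraph `Γ_{n,p}(x)` associated to a tuple `x ∈ E_p^n`. -/
def tupleMG (p n : ℕ) (x : Fin n → Fin p × Fin p) (hx : ValidTuple p n x) : MG :=
  ⟨p, n, fun l => (x l).1, fun l => (x l).2, hx⟩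

/-- Symmetry of a functional on `W^n` under permutation of arguments. -/
def SymmFunc (n : ℕ) (Λ : (Fin n → Kern) → ℝ) : Prop :=
  ∀ (g : Fin n → Kern), (∀ i, g i ∈ Graphons) → ∀ τ : Equiv.Perm (Fin n),
    Λ (g ∘ τ) = Λ g

/-- `S_[0,1]`-invariance of a functional on `W^n`. -/
def SInvFunc (n : ℕ) (Λ : (Fin n → Kern) → ℝ) : Prop :=
  ∀ (g : Fin n → Kern), (∀ i, g i ∈ Graphons) → ∀ σ : ℝ → ℝ, IsMPB σ →
    Λ (fun i => Kern.translate σ (g i)) = Λ g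

/-- `π` is the consistency-constraint matrix `π_{n,k}`: it is invariant under
isomorphism-after-deleting-isolated-vertices in both arguments, and for every `p ≥ 2`,
every symmetric `S_[0,1]`-invariant multilinear functional `Λ : W^n → ℝ`, every
`x ∈ E_p^n` and every complete system `y` of pairwise non-isomorphic representatives
of the multigraphs with `n` edges on `kp` vertices, one has
`C_{n,p}(Λ)(Γ(x)) = Σ_h π(Γ(x)∼, h∼) C_{n,kp}(Λ)(h)`. -/
def ConsistencyMatrix (n k : ℕ) (π : MG → MG → ℕ) : Prop :=
  (∀ G G' H H', StripEquiv G G' → StripEquiv H H' → π G H = π G' H') ∧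
  ∀ p : ℕ, 2 ≤ p → ∀ Λ : (Fin n → Kern) → ℝ,
    SymmFunc n Λ → SInvFunc n Λ → MultilinearOnKerns n Λ →
    ∀ (x : Fin n → Fin p × Fin p) (hx : ValidTuple p n x),
    ∀ (m : ℕ) (y : Fin m → Fin n → Fin (k*p) × Fin (k*p))
      (hy : ∀ i, ValidTuple (k*p) n (y i)),
      (∀ i j, i ≠ j →
        ¬ MGIso (tupleMG (k*p) n (y i) (hy i)) (tupleMG (k*p) n (y j) (hy j))) →
      (∀ (z : Fin n → Fin (k*p) × Fin (k*p)) (hz : ValidTuple (k*p) n z),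
        ∃ i, MGIso (tupleMG (k*p) n z hz) (tupleMG (k*p) n (y i) (hy i))) →
      Λ (fun l => ep p (x l).1 (x l).2)
        = ∑ i : Fin m,
            (π (tupleMG p n x hx) (tupleMG (k*p) n (y i) (hy i)) : ℝ)
              * Λ (fun l => ep (k*p) (y i l).1 (y i l).2)

/-- Adjacency relation of a multigraph. -/
def MG.adj (G : MG) (u v : Fin G.nv) : Prop :=
  ∃ e, (G.s e = u ∧ G.t e = v) ∨ (G.s e = v ∧ G.t e = u)

/-- The homomorphism density of the simplification `G^simp` of a multigraph `G`
(replace each family of parallel edges by a single edge). -/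
def simpHomDensity (G : MG) (f : Kern) : ℝ :=
  ∫ x : Fin G.nv → ℝ,
    ∏ q ∈ Finset.univ.filter (fun q : Fin G.nv × Fin G.nv => q.1 < q.2 ∧ G.adj q.1 q.2),
      f (x q.1) (x q.2) ∂(Measure.pi fun _ => μ01)

/-- Tensor product of two kernels with respect to a fixed measure-preserving map
`φ : [0,1] → [0,1]²`. -/
def tensProd (φ : ℝ → ℝ × ℝ) (f g : Kern) : Kern :=
  fun x y => f (φ x).1 (φ y).1 * g (φ x).2 (φ y).2

/-- `m`-fold tensor power of a kernel. -/
def tensPow (φ : ℝ → ℝ × ℝ) (f : Kern) : ℕ → Kern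
  | 0 => fun _ _ => 1
  | 1 => f
  | (m+2) => tensProd φ f (tensPow φ f (m+1))

/-- A complete system of representatives for the isomorphism classes of multigraphs
with no isolated vertices. -/
def IsRepSet (R : Set MG) : Prop :=
  (∀ G ∈ R, NoIsolated G) ∧ ∀ G : MG, NoIsolated G → ∃! H, H ∈ R ∧ MGIso G H

/-- A `k`-labelled multigraph: a multigraph together with an injective labelling of `k`
distinguished vertices. -/
structure LMG (k : ℕ) where
  G : MG
  lab : Fin k → Fin G.nv
  inj : Function.Injective lab

/-- No unlabelled isolated vertices. -/
def LMG.NoUnlabIsolated {k : ℕ} (H : LMG k) : Prop :=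
  ∀ v, (∃ e, H.G.s e = v ∨ H.G.t e = v) ∨ ∃ a, H.lab a = v

/-- Assignment of coordinates to the vertices of a `k`-labelled multigraph: labelled
vertices get the fixed values `x`, unlabelled ones the integration variables `y`. -/
def LMG.assign {k : ℕ} (H : LMG k) (x : Fin k → ℝ) (y : Fin H.G.nv → ℝ) :
    Fin H.G.nv → ℝ :=
  fun v => if h : ∃ a, H.lab a = v then x h.choose else y v

/-- The partially labelled homomorphism density `t_𝐱(H, f)`. -/
def lhom {k : ℕ} (H : LMG k) (x : Fin k → ℝ) (f : Kern) : ℝ :=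
  ∫ y : Fin H.G.nv → ℝ,
    ∏ e : Fin H.G.ne, f (H.assign x y (H.G.s e)) (H.assign x y (H.G.t e))
    ∂(Measure.pi fun _ => μ01)

/-- The weighted partially labelled homomorphism density `t_𝐱(H, f; w)`. -/
def wlhom {k : ℕ} (H : LMG k) (x : Fin k → ℝ) (f : Kern)
    (w : (Fin H.G.nv → ℝ) → ℝ) : ℝ :=
  ∫ y : Fin H.G.nv → ℝ,
    w (H.assign x y) *
      ∏ e : Fin H.G.ne, f (H.assign x y (H.G.s e)) (H.assign x y (H.G.t e))
    ∂(Measure.pi fun _ => μ01)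

/-- The seminorm `‖w‖_{1,𝐱} = t_𝐱(H, 1, |w|)` of a weight. -/
def wnorm {k : ℕ} (H : LMG k) (x : Fin k → ℝ) (w : (Fin H.G.nv → ℝ) → ℝ) : ℝ :=
  ∫ y : Fin H.G.nv → ℝ, |w (H.assign x y)| ∂(Measure.pi fun _ => μ01)

/-- Label-respecting isomorphism of `k`-labelled multigraphs. -/
def LMGIso {k : ℕ} (H H' : LMG k) : Prop :=
  ∃ (φv : Fin H.G.nv ≃ Fin H'.G.nv) (φe : Fin H.G.ne ≃ Fin H'.G.ne),
    (∀ e, ({H'.G.s (φe e), H'.G.t (φe e)} : Finset (Fin H'.G.nv))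
        = {φv (H.G.s e), φv (H.G.t e)}) ∧
    ∀ a, φv (H.lab a) = H'.lab a

/-- A complete system of representatives for the label-respecting isomorphism classes
of `k`-labelled multigraphs with no unlabelled isolated vertices. -/
def IsLRepSet (k : ℕ) (R : Set (LMG k)) : Prop :=
  (∀ H ∈ R, H.NoUnlabIsolated) ∧
  ∀ H : LMG k, H.NoUnlabIsolated → ∃! H', H' ∈ R ∧ LMGIso H H'

end

noncomputable section

namespace Aux

section Abstract

variable {K : Type*} [AddCommGroup K] [Module ℝ K] {N : ℕ}

theorem line_expand (T : MultilinearMap ℝ (fun _ : Fin N => K) ℝ) (c d : Fin N → K) (t : ℝ) :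
    T (c + t • d) = ∑ s : Finset (Fin N), t ^ s.card * T (s.piecewise d c) := by
  rw [add_comm, MultilinearMap.map_add_univ]
  refine Finset.sum_congr rfl fun s _ => ?_
  have h := T.map_piecewise_smul (fun _ => t) (s.piecewise d c) s
  rw [Finset.prod_const, smul_eq_mul] at h
  rw [← h]
  congr 1
  ext i
  by_cases hi : i ∈ s <;> simp [hi]

theorem line_deriv (T : MultilinearMap ℝ (fun _ : Fin N => K) ℝ) (c d : Fin N → K) :
    HasDerivAt (fun t : ℝ => T (c + t • d)) (∑ e, T (Function.update c e (d e))) 0 := by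
  have h1 : (fun t : ℝ => T (c + t • d))
      = fun t => ∑ s : Finset (Fin N), t ^ s.card * T (s.piecewise d c) := by
    funext t; exact line_expand T c d t
  rw [h1]
  have h2 : HasDerivAt (fun t : ℝ => ∑ s : Finset (Fin N), t ^ s.card * T (s.piecewise d c))
      (∑ s : Finset (Fin N), ((s.card : ℝ) * 0 ^ (s.card - 1)) * T (s.piecewise d c)) 0 := by
    apply HasDerivAt.fun_sum
    intro s _
    exact (hasDerivAt_pow s.card (0:ℝ)).mul_const _
  convert h2 using 1
  symm
  have h3 : ∑ e, T (Function.update c e (d e)) = ∑ s ∈ Finset.powersetCard 1 Finset.univ,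
      ((s.card : ℝ) * 0 ^ (s.card - 1)) * T (s.piecewise d c) := by
    rw [Finset.powersetCard_one, Finset.sum_map]
    refine Finset.sum_congr rfl fun e _ => ?_
    simp [Finset.piecewise_singleton]
  rw [h3]
  symm
  apply Finset.sum_subset (Finset.subset_univ _)
  intro s _ hs
  have hs' : s.card ≠ 1 := by
    intro h
    exact hs (by simp [Finset.mem_powersetCard, h])
  by_cases h0 : s.card = 0
  · simp [h0]
  · have : s.card - 1 ≠ 0 := by omega
    simp [this]

/-- The candidate derivative. -/
def D (T : MultilinearMap ℝ (fun _ : Fin N => K) ℝ) (n : ℕ) (f : K) (g : Fin n → K) : ℝ :=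
  ∑ σ : Fin n → Fin N, if Function.Injective σ then T (Function.extend σ g (fun _ => f)) else 0

theorem extend_snoc {n : ℕ} (σ : Fin n → Fin N) (hσ : Function.Injective σ) (e : Fin N)
    (he : e ∉ Set.range σ) (f : K) (g : Fin (n+1) → K) :
    Function.extend (Fin.snoc σ e : Fin (n+1) → Fin N) g (fun _ => f)
      = Function.update (Function.extend σ (fun i => g i.castSucc) (fun _ => f)) e
          (g (Fin.last n)) := by
  have hinj : Function.Injective (Fin.snoc σ e : Fin (n+1) → Fin N) :=
    Fin.snoc_injective_of_injective hσ he
  funext a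
  by_cases hae : a = e
  · subst hae
    have := hinj.extend_apply g (fun _ => f) (Fin.last n)
    rw [Fin.snoc_last] at this
    rw [this, Function.update_self]
  · rw [Function.update_of_ne hae]
    by_cases ha : ∃ l, σ l = a
    · obtain ⟨l, rfl⟩ := ha
      have := hinj.extend_apply g (fun _ => f) l.castSucc
      rw [Fin.snoc_castSucc] at this
      rw [this, hσ.extend_apply]
    · rw [Function.extend_apply' _ _ _ ha, Function.extend_apply']
      rintro ⟨l, hl⟩
      induction l using Fin.lastCases with
      | last => rw [Fin.snoc_last] at hl; exact hae hl.symm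
      | cast l => rw [Fin.snoc_castSucc] at hl; exact ha ⟨l, hl⟩

theorem D_hasDerivAt (T : MultilinearMap ℝ (fun _ : Fin N => K) ℝ) (n : ℕ) (f : K)
    (g : Fin (n+1) → K) :
    HasDerivAt (fun t : ℝ => D T n (f + t • g (Fin.last n)) (fun i => g i.castSucc))
      (D T (n+1) f g) 0 := by
  have key : D T (n+1) f g = ∑ σ : Fin n → Fin N, ∑ e : Fin N,
      if Function.Injective (Fin.snoc σ e : Fin (n+1) → Fin N) then
        T (Function.extend (Fin.snoc σ e : Fin (n+1) → Fin N) g (fun _ => f)) else 0 := by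
    unfold D
    rw [← (Fin.snocEquiv (fun _ : Fin (n+1) => Fin N)).sum_comp, Fintype.sum_prod_type_right]
    rfl
  rw [key]
  unfold D
  apply HasDerivAt.fun_sum
  intro σ _
  by_cases hσ : Function.Injective σ
  · simp only [hσ, if_true]
    have h := line_deriv T (Function.extend σ (fun i => g i.castSucc) (fun _ => f))
      (Function.extend σ (fun _ => (0:K)) (fun _ => g (Fin.last n)))
    refine (h.congr_of_eventuallyEq (Filter.Eventually.of_forall fun t => ?_)).congr_deriv
      (Eq.symm ?_)
    · dsimp only
      congr 1
      funext a
      by_cases ha : ∃ l, σ l = a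
      · obtain ⟨l, rfl⟩ := ha
        simp [hσ.extend_apply]
      · simp [Function.extend_apply' _ _ _ ha]
    · refine Finset.sum_congr rfl fun e _ => ?_
      by_cases he : e ∈ Set.range σ
      · rw [if_neg (fun h => (Fin.snoc_injective_iff.1 h).2 he)]
        obtain ⟨l, rfl⟩ := he
        rw [hσ.extend_apply, T.map_update_zero]
      · rw [if_pos (Fin.snoc_injective_of_injective hσ he), extend_snoc σ hσ e he,
          Function.extend_apply' _ _ _ he]
  · have h0 : ∀ e : Fin N, ¬ Function.Injective (Fin.snoc σ e : Fin (n+1) → Fin N) :=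
      fun e h => hσ (Fin.snoc_injective_iff.1 h).1
    simp only [hσ, h0, if_false, Finset.sum_const_zero]
    exact hasDerivAt_const _ _

theorem D_zero (T : MultilinearMap ℝ (fun _ : Fin N => K) ℝ) (f : K) (g : Fin 0 → K) :
    D T 0 f g = T (fun _ => f) := by
  unfold D
  rw [Fintype.sum_unique, if_pos (Function.injective_of_subsingleton _)]
  congr 1
  funext a
  exact Function.extend_apply' _ _ _ (fun ⟨l, _⟩ => l.elim0)

theorem smooth (T : MultilinearMap ℝ (fun _ : Fin N => K) ℝ) (f : K) {m : ℕ} (g : Fin m → K)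
    (n : ℕ) : ContDiff ℝ n (fun lam : Fin m → ℝ => T (fun _ => f + ∑ i, lam i • g i)) := by
  have h : (fun lam : Fin m → ℝ => T (fun _ => f + ∑ i, lam i • g i))
      = fun lam => ∑ r : Fin N → Fin (m+1),
        (∏ e, (Fin.cons 1 lam : Fin (m+1) → ℝ) (r e)) *
          T (fun e => (Fin.cons f g : Fin (m+1) → K) (r e)) := by
    funext lam
    have h1 : (fun _ : Fin N => f + ∑ i, lam i • g i) = fun _ : Fin N => ∑ j : Fin (m+1),
        (Fin.cons 1 lam : Fin (m+1) → ℝ) j • (Fin.cons f g : Fin (m+1) → K) j := by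
      funext _
      rw [Fin.sum_univ_succ]
      simp
    rw [h1, T.map_sum]
    refine Finset.sum_congr rfl fun r _ => ?_
    rw [T.map_smul_univ, smul_eq_mul]
  rw [h]
  apply ContDiff.sum
  intro r _
  apply ContDiff.mul _ contDiff_const
  apply contDiff_prod
  intro e _
  generalize r e = j
  induction j using Fin.cases with
  | zero => simpa using contDiff_const
  | succ j => simpa using contDiff_apply ℝ ℝ j

end Abstract

/-- The submodule of bounded symmetric measurable kernels. -/
def KK : Submodule ℝ Kern where
  carrier := {f | IsKernel f}
  add_mem' := by
    rintro f g ⟨⟨hf, hfs⟩, C, hC⟩ ⟨⟨hg, hgs⟩, C', hC'⟩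
    refine ⟨⟨hf.add hg, fun x y => ?_⟩, C + C', fun x y => ?_⟩
    · simp [hfs x y, hgs x y]
    · exact (abs_add_le _ _).trans (add_le_add (hC x y) (hC' x y))
  zero_mem' := ⟨⟨measurable_const, fun _ _ => rfl⟩, 0, fun x y => by simp⟩
  smul_mem' := by
    rintro c f ⟨⟨hf, hfs⟩, C, hC⟩
    refine ⟨⟨hf.const_smul c, fun x y => ?_⟩, |c| * C, fun x y => ?_⟩
    · simp [hfs x y]
    · simp only [Pi.smul_apply, smul_eq_mul, abs_mul]
      exact mul_le_mul_of_nonneg_left (hC x y) (abs_nonneg c)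

theorem graphon_kernel {f : Kern} (hf : f ∈ Graphons) : f ∈ KK := by
  refine ⟨hf.1, 1, fun x y => ?_⟩
  have := hf.2 x y
  rw [abs_le]
  exact ⟨by linarith [this.1], this.2⟩

theorem adm_kernel {f g : Kern} (hf : f ∈ Graphons) (hg : g ∈ adm Graphons f) : g ∈ KK := by
  obtain ⟨ε, h0, -, h⟩ := hg
  have h1 := graphon_kernel (h (ε/2) (by linarith) (by linarith))
  have h2 : g = (ε/2)⁻¹ • ((f + (ε/2) • g) - f) := by
    rw [add_sub_cancel_left, smul_smul, inv_mul_cancel₀ (by linarith), one_smul]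
  rw [h2]
  exact KK.smul_mem _ (KK.sub_mem h1 (graphon_kernel hf))

theorem convex_graphons {f g : Kern} (hf : f ∈ Graphons) (hg : g ∈ Graphons) {a b : ℝ}
    (ha : 0 ≤ a) (hb : 0 ≤ b) (hab : a + b = 1) : a • f + b • g ∈ Graphons := by
  have h := KK.add_mem (KK.smul_mem a (graphon_kernel hf)) (KK.smul_mem b (graphon_kernel hg))
  refine ⟨h.1, fun x y => ?_⟩
  exact (convex_Icc (0:ℝ) 1) (hf.2 x y) (hg.2 x y) ha hb hab

/-- Evaluation along an edge. -/
def ev (G : MG) (e : Fin G.ne) : KK →ₗ[ℝ] ((Fin G.nv → ℝ) → ℝ) where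
  toFun f := fun x => f.1 (x (G.s e)) (x (G.t e))
  map_add' _ _ := rfl
  map_smul' _ _ := rfl

/-- The integrand, as a multilinear map. -/
def MM (G : MG) : MultilinearMap ℝ (fun _ : Fin G.ne => KK) ((Fin G.nv → ℝ) → ℝ) :=
  (MultilinearMap.mkPiAlgebra ℝ (Fin G.ne) ((Fin G.nv → ℝ) → ℝ)).compLinearMap (ev G)

theorem MM_apply (G : MG) (φ : Fin G.ne → KK) (x : Fin G.nv → ℝ) :
    MM G φ x = ∏ e, (φ e).1 (x (G.s e)) (x (G.t e)) := by
  simp [MM, ev]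

theorem MM_integrable (G : MG) (φ : Fin G.ne → KK) :
    Integrable (MM G φ) (Measure.pi fun _ => μ01) := by
  have hφ : ∀ e, ∃ C : ℝ, ∀ x y, |(φ e).1 x y| ≤ C := fun e => (φ e).2.2
  choose C hC using hφ
  have hm : Measurable (MM G φ) := by
    have : MM G φ = fun x => ∏ e, (φ e).1 (x (G.s e)) (x (G.t e)) := funext (MM_apply G φ)
    rw [this]
    apply Finset.measurable_fun_prod
    intro e _
    have h2 : Measurable fun x : Fin G.nv → ℝ => (x (G.s e), x (G.t e)) :=
      (measurable_pi_apply _).prodMk (measurable_pi_apply _)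
    exact (φ e).2.1.1.comp h2
  refine Integrable.of_bound hm.aestronglyMeasurable (∏ e, C e) (ae_of_all _ fun x => ?_)
  rw [MM_apply, Real.norm_eq_abs, Finset.abs_prod]
  exact Finset.prod_le_prod (fun _ _ => abs_nonneg _) (fun e _ => hC e _ _)

/-- The multilinear homomorphism density. -/
def TT (G : MG) : MultilinearMap ℝ (fun _ : Fin G.ne => KK) ℝ where
  toFun φ := ∫ x, MM G φ x ∂(Measure.pi fun _ => μ01)
  map_update_add' m i a b := by
    rw [MultilinearMap.map_update_add]
    exact integral_add (MM_integrable G _) (MM_integrable G _)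
  map_update_smul' m i c a := by
    rw [MultilinearMap.map_update_smul]
    exact integral_smul c _

theorem TT_apply (G : MG) (φ : Fin G.ne → KK) :
    TT G φ = ∫ x : Fin G.nv → ℝ, ∏ e, (φ e).1 (x (G.s e)) (x (G.t e))
      ∂(Measure.pi fun _ => μ01) := by
  simp only [← MM_apply]
  rfl

theorem adm_step {f h g : Kern} (hg : g ∈ adm Graphons f)
    {t t₀ : ℝ} (ht₀ : f + t₀ • h ∈ Graphons) {r : ℝ} (hr0 : 0 ≤ r) (hr1 : r < 1)
    (htr : t = r * t₀) : g ∈ adm Graphons (f + t • h) := by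
  obtain ⟨ε, h0, h1, hh⟩ := hg
  have hpos : 0 < 1 - r := by linarith
  refine ⟨(1 - r) * ε, by positivity, by nlinarith, fun δ hδ hδ' => ?_⟩
  have hd : δ / (1 - r) < ε := by rw [div_lt_iff₀ hpos]; linarith
  have := convex_graphons (hh (δ / (1 - r)) (by positivity) hd) ht₀ hpos.le hr0 (by ring)
  convert this using 1
  rw [smul_add, smul_add, smul_smul, smul_smul, mul_div_cancel₀ _ hpos.ne', htr, sub_smul]
  simp only [one_smul]
  abel

theorem adm_eventually {f h : Kern} (hh : h ∈ adm Graphons f) {n : ℕ} (g : Fin n → Kern)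
    (hg : ∀ i, g i ∈ adm Graphons f) :
    ∀ᶠ t in nhdsWithin (0:ℝ) {t : ℝ | t ≠ 0 ∧ f + t • h ∈ Graphons},
      f + t • h ∈ Graphons ∧ ∀ i, g i ∈ adm Graphons (f + t • h) := by
  obtain ⟨ε, h0, -, hε⟩ := hh
  have hp : f + (ε/2) • h ∈ Graphons := hε _ (by linarith) (by linarith)
  by_cases hneg : ∃ t₀ : ℝ, t₀ < 0 ∧ f + t₀ • h ∈ Graphons
  · obtain ⟨t₀, ht₀, hU⟩ := hneg
    have hN : Set.Ioo t₀ (ε/2) ∈ nhds (0:ℝ) := Ioo_mem_nhds ht₀ (by linarith)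
    filter_upwards [mem_nhdsWithin_of_mem_nhds hN, self_mem_nhdsWithin] with t ht htU
    refine ⟨htU.2, fun i => ?_⟩
    rcases le_total 0 t with h | h
    · exact adm_step (hg i) hp (r := t / (ε/2)) (by positivity)
        (by rw [div_lt_one (by linarith)]; exact ht.2) (by field_simp)
    · exact adm_step (hg i) hU (r := t / t₀) (div_nonneg_of_nonpos h ht₀.le)
        (by rw [div_lt_one_of_neg ht₀]; exact ht.1) (div_mul_cancel₀ t ht₀.ne).symm
  · push Not at hneg
    filter_upwards [mem_nhdsWithin_of_mem_nhds (Iio_mem_nhds (show (0:ℝ) < ε/2 by linarith)),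
      self_mem_nhdsWithin] with t ht htU
    refine ⟨htU.2, fun i => ?_⟩
    have h : 0 ≤ t := by
      by_contra hlt
      exact hneg t (not_le.1 hlt) htU.2
    exact adm_step (hg i) hp (r := t / (ε/2)) (by positivity)
        (by rw [div_lt_one (by linarith)]; exact ht) (by field_simp)

theorem adm_neBot {f h : Kern} (hh : h ∈ adm Graphons f) :
    (nhdsWithin (0:ℝ) {t : ℝ | t ≠ 0 ∧ f + t • h ∈ Graphons}).NeBot := by
  obtain ⟨ε, h0, -, hε⟩ := hh
  have h1 : (nhdsWithin (0:ℝ) (Set.Ioo 0 ε)).NeBot := by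
    rw [nhdsWithin_Ioo_eq_nhdsGT h0]
    infer_instance
  exact h1.mono (nhdsWithin_mono _ fun t ht => ⟨ht.1.ne', hε t ht.1.le ht.2⟩)

theorem gD_eq (G : MG) : ∀ (n : ℕ) (f : KK) (g : Fin n → KK), (f : Kern) ∈ Graphons →
    (∀ i, (g i : Kern) ∈ adm Graphons (f : Kern)) →
    gD Graphons (homDensity G) n (f : Kern) (fun i => (g i : Kern)) = D (TT G) n f g := by
  intro n
  induction n with
  | zero =>
    intro f g _ _
    rw [D_zero, TT_apply]
    rfl
  | succ n ih =>
    intro f g hf hg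
    have := adm_neBot (hg (Fin.last n))
    apply Tendsto.limUnder_eq
    have hd := (D_hasDerivAt (TT G) n f g).tendsto_slope_zero
    have hd' := hd.mono_left (nhdsWithin_mono (0:ℝ)
      (show {t : ℝ | t ≠ 0 ∧ (f:Kern) + t • (g (Fin.last n) : Kern) ∈ Graphons} ⊆ {0}ᶜ from
        fun t ht => ht.1))
    refine hd'.congr' ?_
    filter_upwards [adm_eventually (hg (Fin.last n)) (fun i : Fin n => (g i.castSucc : Kern))
      (fun i => hg i.castSucc)] with t ht
    have e1 := ih (f + t • g (Fin.last n)) (fun i => g i.castSucc) ht.1 ht.2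
    have e2 := ih f (fun i => g i.castSucc) hf (fun i => hg i.castSucc)
    have e1' : gD Graphons (homDensity G) n ((f:Kern) + t • (g (Fin.last n) : Kern))
        (fun i => (g i.castSucc : Kern))
        = D (TT G) n (f + t • g (Fin.last n)) (fun i => g i.castSucc) := e1
    rw [e1', e2]
    simp only [zero_add, zero_smul, add_zero, smul_eq_mul]
    rw [div_eq_inv_mul]

theorem prod_split {n N : ℕ} (σ : Fin n → Fin N) (hσ : Function.Injective σ) (f : KK)
    (g : Fin n → KK) (A : Finset (Fin N)) (hA : Finset.univ.image σ = A) (u v : Fin N → ℝ) :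
    ∏ e, (Function.extend σ g (fun _ => f) e).1 (u e) (v e)
      = (∏ l, (g l).1 (u (σ l)) (v (σ l))) * ∏ e ∈ Finset.univ \ A, f.1 (u e) (v e) := by
  rw [← Finset.prod_sdiff (Finset.subset_univ A), mul_comm]
  congr 1
  · rw [← hA, Finset.prod_image (fun a _ b _ h => hσ h)]
    exact Finset.prod_congr rfl fun l _ => by rw [hσ.extend_apply]
  · refine Finset.prod_congr rfl fun e he => ?_
    rw [Function.extend_apply']
    rintro ⟨l, rfl⟩
    rw [Finset.mem_sdiff, ← hA] at he
    exact he.2 (Finset.mem_image_of_mem _ (Finset.mem_univ _))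

theorem image_eq {n N : ℕ} {σ : Fin n → Fin N} (hσ : Function.Injective σ) {A : Finset (Fin N)}
    (hA : A.card = n) (h : ∀ l, σ l ∈ A) : Finset.univ.image σ = A := by
  apply Finset.eq_of_subset_of_card_le
  · intro e he
    obtain ⟨l, -, rfl⟩ := Finset.mem_image.1 he
    exact h l
  · rw [Finset.card_image_of_injective _ hσ, hA]; simp

theorem D_formula (G : MG) (n : ℕ) (f : KK) (g : Fin n → KK) :
    D (TT G) n f g
        = ∑ A ∈ Finset.powersetCard n (Finset.univ : Finset (Fin G.ne)),
            ∑ σ ∈ Finset.univ.filter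
                (fun σ : Fin n → Fin G.ne => Function.Injective σ ∧ ∀ l, σ l ∈ A),
              ∫ x : Fin G.nv → ℝ,
                (∏ l : Fin n, (g l).1 (x (G.s (σ l))) (x (G.t (σ l)))) *
                  ∏ e ∈ Finset.univ \ A, f.1 (x (G.s e)) (x (G.t e))
                ∂(Measure.pi fun _ => μ01) := by
  have h1 : ∀ A ∈ Finset.powersetCard n (Finset.univ : Finset (Fin G.ne)),
      (∑ σ ∈ Finset.univ.filter
                (fun σ : Fin n → Fin G.ne => Function.Injective σ ∧ ∀ l, σ l ∈ A),
              ∫ x : Fin G.nv → ℝ,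
                (∏ l : Fin n, (g l).1 (x (G.s (σ l))) (x (G.t (σ l)))) *
                  ∏ e ∈ Finset.univ \ A, f.1 (x (G.s e)) (x (G.t e))
                ∂(Measure.pi fun _ => μ01))
      = ∑ σ ∈ (Finset.univ.filter
            (fun σ : Fin n → Fin G.ne => Function.Injective σ)).filter
              (fun σ => Finset.univ.image σ = A),
          TT G (Function.extend σ g (fun _ => f)) := by
    intro A hA
    have hc := (Finset.mem_powersetCard.1 hA).2
    refine Finset.sum_congr ?_ ?_
    · ext σ
      simp only [Finset.mem_filter, Finset.mem_univ, true_and]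
      refine and_congr_right fun hσ => ⟨fun h => image_eq hσ hc h, ?_⟩
      rintro rfl l
      exact Finset.mem_image_of_mem _ (Finset.mem_univ _)
    · intro σ hσ
      simp only [Finset.mem_filter, Finset.mem_univ, true_and] at hσ
      rw [TT_apply]
      congr 1
      funext x
      exact (prod_split σ hσ.1 f g A hσ.2 (fun e => x (G.s e)) (fun e => x (G.t e))).symm
  rw [Finset.sum_congr rfl h1, Finset.sum_fiberwise_of_maps_to, Finset.sum_filter]
  · rfl
  · intro σ hσ
    simp only [Finset.mem_filter, Finset.mem_univ, true_and] at hσ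
    rw [Finset.mem_powersetCard]
    refine ⟨Finset.subset_univ _, ?_⟩
    rw [Finset.card_image_of_injective _ hσ]; simp

theorem homDensity_eq (G : MG) (f : KK) : homDensity G f.1 = TT G (fun _ => f) := by
  rw [TT_apply]; rfl

end Aux

end

/-- For every multigraph `H`, the homomorphism density `t(H, ·)` is
Gâteaux smooth on `W`; its derivatives of order `> |E(H)|` vanish, and for
`n ≤ |E(H)|` they are given by the explicit sum over `n`-element edge subsets `A` and
bijections `σ : {1,…,n} → A`. -/
theorem stmt12 (G : MG) :
    GSmooth Graphons (homDensity G) ∧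
    (∀ n : ℕ, G.ne < n → ∀ f ∈ Graphons, ∀ g : Fin n → Kern,
      (∀ i, g i ∈ adm Graphons f) →
      gD Graphons (homDensity G) n f g = 0) ∧
    (∀ n : ℕ, n ≤ G.ne → ∀ f ∈ Graphons, ∀ g : Fin n → Kern,
      (∀ i, g i ∈ adm Graphons f) →
      gD Graphons (homDensity G) n f g
        = ∑ A ∈ Finset.powersetCard n (Finset.univ : Finset (Fin G.ne)),
            ∑ σ ∈ Finset.univ.filter
                (fun σ : Fin n → Fin G.ne => Function.Injective σ ∧ ∀ l, σ l ∈ A),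
              ∫ x : Fin G.nv → ℝ,
                (∏ l : Fin n, g l (x (G.s (σ l))) (x (G.t (σ l)))) *
                  ∏ e ∈ Finset.univ \ A, f (x (G.s e)) (x (G.t e))
                ∂(Measure.pi fun _ => μ01)) := by
  refine ⟨?_, ?_, ?_⟩
  · intro n f hf m g hg
    let f' : Aux.KK := ⟨f, Aux.graphon_kernel hf⟩
    let g' : Fin m → Aux.KK := fun i => ⟨g i, Aux.adm_kernel hf (hg i)⟩
    refine ⟨_, Aux.smooth (Aux.TT G) f' g' n, fun lam _ => ?_⟩
    rw [← Aux.homDensity_eq]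
    congr 1
    simp [f', g']
  · intro n hn f hf g hg
    have h := Aux.gD_eq G n ⟨f, Aux.graphon_kernel hf⟩
      (fun i => ⟨g i, Aux.adm_kernel hf (hg i)⟩) hf hg
    refine h.trans ?_
    unfold Aux.D
    refine Finset.sum_eq_zero fun σ _ => if_neg fun hσ => ?_
    have := Fintype.card_le_of_injective σ hσ
    simp at this
    omega
  · intro n _ f hf g hg
    have h := Aux.gD_eq G n ⟨f, Aux.graphon_kernel hf⟩
      (fun i => ⟨g i, Aux.adm_kernel hf (hg i)⟩) hf hg
    exact h.trans (Aux.D_formula G n _ _)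
end

section
/- Let H be a multigraph with n edges and no isolated vertices, let p ≥ 2, and let h be a multigraph with n edges on vertex set of size p (isolated vertices allowed). Fix a bijection φ : V(h) → {1,…,p} and for each edge e ∈ E(h) let g_e := e^p_{(φ(e_s), φ(e_t))}. Then the n-th mixed Gâteaux derivative of t(H,−) at the zero graphon in the directions (g_e)_{e∈E(h)} equals |Surj(H, h̃)| / p^{|V(H)|}, where h̃ is h with its isolated vertices removed and Surj(H, h̃) is the set of surjective node-and-edge homomorphisms from H onto h̃. In particular this derivative is strictly positive if and only if there exists a surjective node-and-edge homomorphism from H onto h̃. -/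
open MeasureTheory Filter Set Topology
open scoped BigOperators Classical ENNReal

noncomputable section Stmt13Aux

/-- iterated partial derivatives `∂_{k-1} ⋯ ∂_0` -/
def iterPD {n : ℕ} (P : MvPolynomial (Fin n) ℝ) : (k : ℕ) → k ≤ n → MvPolynomial (Fin n) ℝ
  | 0, _ => P
  | k + 1, hk => MvPolynomial.pderiv ⟨k, hk⟩ (iterPD P k (Nat.le_of_succ_le hk))

lemma hasDerivAt_eval_single {n : ℕ} (Q : MvPolynomial (Fin n) ℝ) (lam : Fin n → ℝ) (i : Fin n) :
    HasDerivAt (fun t : ℝ => MvPolynomial.eval (lam + Pi.single i t) Q)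
      (MvPolynomial.eval lam (MvPolynomial.pderiv i Q)) 0 := by
  induction Q using MvPolynomial.induction_on with
  | C a => simpa using hasDerivAt_const (0:ℝ) a
  | add p q hp hq => simp only [map_add]; exact hp.add hq
  | mul_X p j hp =>
    have hX : HasDerivAt (fun t : ℝ => lam j + (Pi.single i t : Fin n → ℝ) j)
        ((Pi.single i 1 : Fin n → ℝ) j) 0 := by
      apply HasDerivAt.const_add
      by_cases hij : j = i
      · subst hij; simp only [Pi.single_eq_same]; exact hasDerivAt_id (0:ℝ)
      · simpa [hij] using hasDerivAt_const (0:ℝ) (0:ℝ)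
    have := hp.mul hX
    refine (this.congr_deriv ?_).congr_of_eventuallyEq (Eventually.of_forall fun t => by simp)
    · simp [MvPolynomial.pderiv_mul, MvPolynomial.pderiv_X]
      by_cases hij : j = i
      · subst hij; simp; ring
      · simp [hij]; ring

lemma gD_eq_iterPD {E : Type*} [AddCommGroup E] [Module ℝ E] (U : Set E) (F : E → ℝ) (n : ℕ)
    (g : Fin n → E) (P : MvPolynomial (Fin n) ℝ) (good : Set (Fin n → ℝ))
    (hF : ∀ lam ∈ good, F (∑ i, lam i • g i) = MvPolynomial.eval lam P)
    (hne : ∀ lam ∈ good, ∀ i,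
      (nhdsWithin (0:ℝ) {t : ℝ | t ≠ 0 ∧ (∑ j, lam j • g j) + t • g i ∈ U}).NeBot)
    (hgood : ∀ lam ∈ good, ∀ i,
      ∀ᶠ t in nhdsWithin (0:ℝ) {t : ℝ | t ≠ 0 ∧ (∑ j, lam j • g j) + t • g i ∈ U},
        lam + Pi.single i t ∈ good)
    (k : ℕ) (hk : k ≤ n) : ∀ lam ∈ good,
      gD U F k (∑ i, lam i • g i) (fun i => g (Fin.castLE hk i))
        = MvPolynomial.eval lam (iterPD P k hk) := by
  induction k with
  | zero => intro lam hl; exact hF lam hl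
  | succ k ih =>
    intro lam hl
    have hk' : k ≤ n := Nat.le_of_succ_le hk
    set i : Fin n := ⟨k, hk⟩ with hi
    have hlast : g (Fin.castLE hk (Fin.last k)) = g i := rfl
    have hcs : (fun j : Fin k => g (Fin.castLE hk j.castSucc)) = fun j => g (Fin.castLE hk' j) := rfl
    simp only [gD, iterPD]
    rw [hcs, hlast]
    have hN := hne lam hl i
    apply Tendsto.limUnder_eq
    have hd := (hasDerivAt_eval_single (iterPD P k hk') lam i).tendsto_slope_zero
    have hd' := hd.mono_left (nhdsWithin_mono (0:ℝ)
      (show {t : ℝ | t ≠ 0 ∧ (∑ j, lam j • g j) + t • g i ∈ U} ⊆ {0}ᶜ from fun t ht => ht.1))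
    refine hd'.congr' ?_
    filter_upwards [hgood lam hl i] with t ht
    have e1 : (∑ j, lam j • g j) + t • g i = ∑ j, (lam + Pi.single i t : Fin n → ℝ) j • g j := by
      simp only [Pi.add_apply, add_smul, Finset.sum_add_distrib]
      congr 1
      rw [Finset.sum_eq_single i]
      · simp
      · intro b _ hb; simp [hb]
      · simp
    rw [e1, ih hk' _ ht, ih hk' _ hl]
    simp [div_eq_inv_mul]

lemma coeff_pderiv_aux {n : ℕ} (Q : MvPolynomial (Fin n) ℝ) (i : Fin n) (m : Fin n →₀ ℕ) :
    MvPolynomial.coeff m (MvPolynomial.pderiv i Q)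
      = MvPolynomial.coeff (m + Finsupp.single i 1) Q * ((m i : ℝ) + 1) := by
  induction Q using MvPolynomial.induction_on' with
  | monomial u a =>
    rw [MvPolynomial.pderiv_monomial, MvPolynomial.coeff_monomial, MvPolynomial.coeff_monomial]
    by_cases h1 : u = m + Finsupp.single i 1
    · subst h1; simp
    · rw [if_neg h1]
      by_cases h2 : u - Finsupp.single i 1 = m
      · rw [if_pos h2]
        have : u i = 0 := by
          by_contra h3
          apply h1
          rw [← h2]
          ext j
          by_cases hj : j = i
          · subst hj; simp; omega
          · simp [Finsupp.single_apply, Ne.symm hj]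
        simp [this]
      · rw [if_neg h2]; simp
  | add p q hp hq => simp [hp, hq, add_mul]

lemma coeff_iterPD {n : ℕ} (P : MvPolynomial (Fin n) ℝ) (k : ℕ) (hk : k ≤ n) :
    ∀ m : Fin n →₀ ℕ, (∀ i : Fin n, i.1 < k → m i = 0) →
    MvPolynomial.coeff m (iterPD P k hk)
      = MvPolynomial.coeff (m + ∑ i : Fin n, if i.1 < k then Finsupp.single i 1 else 0) P := by
  induction k with
  | zero => intro m _; simp [iterPD]
  | succ k ih =>
    intro m hm
    rw [iterPD, coeff_pderiv_aux, ih]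
    · rw [hm ⟨k, hk⟩ (by simp)]
      simp only [Nat.cast_zero, zero_add, mul_one]
      congr 1
      rw [add_assoc]
      congr 1
      have : ∀ i : Fin n, (if i.1 < k + 1 then (Finsupp.single i 1 : Fin n →₀ ℕ) else 0)
          = (if i = ⟨k, hk⟩ then Finsupp.single i 1 else 0)
            + (if i.1 < k then Finsupp.single i 1 else 0) := by
        intro i
        by_cases h1 : i.1 < k
        · have : i ≠ ⟨k, hk⟩ := by intro h; simp [h] at h1
          simp [h1, this, Nat.lt_succ_of_lt h1]
        · by_cases h2 : i = ⟨k, hk⟩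
          · subst h2; simp
          · have : ¬ i.1 < k + 1 := by
              intro h; apply h2; ext; simp; omega
            simp [h1, h2, this]
      rw [Finset.sum_congr rfl (fun i _ => this i), Finset.sum_add_distrib]
      simp
    · intro i hi
      have : i ≠ ⟨k, hk⟩ := by intro h; simp [h] at hi
      simp [Finsupp.single_apply, Ne.symm this, hm i (Nat.lt_succ_of_lt hi)]

lemma iterPD_full {n : ℕ} (T : (Fin n → Fin n) → ℝ) :
    MvPolynomial.eval (0 : Fin n → ℝ) (iterPD (∑ c : Fin n → Fin n,
        MvPolynomial.C (T c) * ∏ e, MvPolynomial.X (c e)) n le_rfl)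
      = ∑ c : Fin n → Fin n, if Function.Surjective c then T c else 0 := by
  have h0 : ∀ Q : MvPolynomial (Fin n) ℝ, MvPolynomial.eval (0 : Fin n → ℝ) Q
      = MvPolynomial.coeff 0 Q := by
    intro Q
    rw [← MvPolynomial.constantCoeff_eq, ← MvPolynomial.eval_zero]
  rw [h0, coeff_iterPD _ _ _ _ (by simp), MvPolynomial.coeff_sum]
  refine Finset.sum_congr rfl fun c _ => ?_
  have hX : (∏ e, MvPolynomial.X (c e) : MvPolynomial (Fin n) ℝ)
      = MvPolynomial.monomial (∑ e, Finsupp.single (c e) 1) 1 := by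
    rw [MvPolynomial.monomial_sum_one]; rfl
  rw [hX, MvPolynomial.coeff_C_mul, MvPolynomial.coeff_monomial]
  have : (∑ e, Finsupp.single (c e) 1 : Fin n →₀ ℕ)
      = 0 + ∑ i : Fin n, (if i.1 < n then Finsupp.single i 1 else 0) ↔ Function.Surjective c := by
    simp only [Fin.is_lt, if_true, zero_add]
    constructor
    · intro h v
      have h' := DFunLike.congr_fun h v
      simp only [Finsupp.finsetSum_apply, Finsupp.single_apply] at h'
      simp only [Finset.sum_ite_eq', Finset.mem_univ, if_true] at h'
      by_contra hv
      push Not at hv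
      simp [hv] at h'
    · intro h
      have hb : Function.Bijective c := Finite.injective_iff_bijective.1
        (Finite.injective_iff_surjective.2 h)
      exact Function.Bijective.sum_comp hb (fun i => (Finsupp.single i 1 : Fin n →₀ ℕ))
  simp only [this]
  split_ifs <;> simp

lemma cell_disj {p : ℕ} (hp : 0 < p) {a b : Fin p} {x : ℝ} (ha : x ∈ cell p a)
    (hb : x ∈ cell p b) : a = b := by
  have hp' : (0:ℝ) < p := by exact_mod_cast hp
  simp only [cell, Set.mem_Ioc, div_lt_iff₀ hp', le_div_iff₀ hp'] at ha hb
  have h1 : (a.1 : ℝ) < b.1 + 1 := by linarith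
  have h2 : (b.1 : ℝ) < a.1 + 1 := by linarith
  have h1' : a.1 < b.1 + 1 := by exact_mod_cast h1
  have h2' : b.1 < a.1 + 1 := by exact_mod_cast h2
  ext; omega

lemma cell_meas {p : ℕ} (a : Fin p) : MeasurableSet (cell p a) := measurableSet_Ioc

lemma cell_vol {p : ℕ} (hp : 0 < p) (a : Fin p) : μ01.real (cell p a) = 1 / p := by
  have hp' : (0:ℝ) < p := by exact_mod_cast hp
  have ha : (a.1 : ℝ) + 1 ≤ p := by exact_mod_cast a.2
  rw [measureReal_restrict_apply (cell_meas a)]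
  have : cell p a ∩ Set.Icc 0 1 = cell p a := by
    apply Set.inter_eq_left.2
    intro x hx
    simp only [cell, Set.mem_Ioc, div_lt_iff₀ hp', le_div_iff₀ hp'] at hx
    have h0 : (0:ℝ) ≤ a.1 := by positivity
    constructor <;> nlinarith
  rw [this, cell, Real.volume_real_Ioc_of_le (by gcongr; linarith)]
  field_simp; ring

lemma ep_graphon {p : ℕ} (a b : Fin p) : IsGraphon (ep p a b) := by
  refine ⟨⟨?_, ?_⟩, ?_⟩
  · unfold ep Function.uncurry
    refine Measurable.ite ?_ measurable_const measurable_const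
    exact MeasurableSet.union ((cell_meas a).prod (cell_meas b)) ((cell_meas b).prod (cell_meas a))
  · intro x y
    unfold ep
    congr 1
    apply propext
    tauto
  · intro x y
    unfold ep
    split_ifs <;> simp

/-- compatibility of a vertex map `a` and an edge map `c` -/
def Cpt {n v p : ℕ} (s t : Fin n → Fin v) (s' t' : Fin n → Fin p) (c : Fin n → Fin n)
    (a : Fin v → Fin p) : Prop :=
  ∀ e, ({s' (c e), t' (c e)} : Finset (Fin p)) = {a (s e), a (t e)}

lemma pair_eq {α : Type*} [DecidableEq α] (a b c d : α) :
    (({a, b} : Finset α) = {c, d}) ↔ (a = c ∧ b = d) ∨ (a = d ∧ b = c) := by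
  rw [← Finset.coe_inj]
  simp [Set.pair_eq_pair_iff]

lemma prod_ep {n v p : ℕ} (hp : 0 < p) (s t : Fin n → Fin v) (hni : ∀ w, ∃ e, s e = w ∨ t e = w)
    (s' t' : Fin n → Fin p) (c : Fin n → Fin n) (x : Fin v → ℝ) :
    ∏ e, ep p (s' (c e)) (t' (c e)) (x (s e)) (x (t e))
      = ∑ a : Fin v → Fin p, if Cpt s t s' t' c a then
          (Set.univ.pi fun w => cell p (a w)).indicator (fun _ => (1:ℝ)) x else 0 := by
  have hep : ∀ a b x y, ep p a b x y = 
    if (x ∈ cell p a ∧ y ∈ cell p b) ∨ (x ∈ cell p b ∧ y ∈ cell p a) then 1 else 0 :=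
      fun _ _ _ _ => rfl
  by_cases hall : ∃ a : Fin v → Fin p, ∀ w, x w ∈ cell p (a w)
  · obtain ⟨a, ha⟩ := hall
    have hmem : ∀ w b, x w ∈ cell p b ↔ b = a w := fun w b =>
      ⟨fun hb => cell_disj hp hb (ha w), fun hb => hb ▸ ha w⟩
    rw [Finset.sum_eq_single a]
    · have : x ∈ Set.univ.pi fun w => cell p (a w) := fun w _ => ha w
      rw [Set.indicator_of_mem this]
      simp only [hep, hmem]
      have h2 : ∀ e, ((s' (c e) = a (s e) ∧ t' (c e) = a (t e)) ∨
          (t' (c e) = a (s e) ∧ s' (c e) = a (t e))) ↔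
          ({s' (c e), t' (c e)} : Finset (Fin p)) = {a (s e), a (t e)} := by
        intro e
        rw [pair_eq]; tauto
      simp only [h2]
      rw [Finset.prod_ite_zero]
      simp only [Finset.mem_univ, true_implies, Finset.prod_const_one, Cpt]
      congr 1
    · intro b _ hb
      have : x ∉ Set.univ.pi fun w => cell p (b w) := by
        intro hx
        apply hb
        funext w
        exact (hmem w _).1 (hx w trivial)
      rw [Set.indicator_of_notMem this]; simp
    · simp
  · have hw : ∃ w, ∀ b, x w ∉ cell p b := by
      by_contra hcon
      push Not at hcon
      choose a ha using hcon
      exact hall ⟨a, ha⟩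
    obtain ⟨w, hw⟩ := hw
    rw [Finset.sum_eq_zero]
    · obtain ⟨e, he⟩ := hni w
      apply Finset.prod_eq_zero (Finset.mem_univ e)
      rw [hep, if_neg]
      rcases he with he | he <;> rw [he] <;> simp [hw]
    · intro b _
      have : x ∉ Set.univ.pi fun w => cell p (b w) := fun hx => hw _ (hx w trivial)
      rw [Set.indicator_of_notMem this]; simp

lemma integral_box {v p : ℕ} (hp : 0 < p) (a : Fin v → Fin p) :
    ∫ x, (Set.univ.pi fun w => cell p (a w)).indicator (fun _ => (1:ℝ)) x
      ∂(Measure.pi fun _ : Fin v => μ01) = (1 / p) ^ v := by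
  have hm : MeasurableSet (Set.univ.pi fun w => cell p (a w)) :=
    MeasurableSet.univ_pi fun w => cell_meas _
  rw [integral_indicator_const _ hm, Measure.real, Measure.pi_pi, ENNReal.toReal_prod]
  have : ∀ w, (μ01 (cell p (a w))).toReal = 1 / p := fun w => cell_vol hp _
  rw [Finset.prod_congr rfl fun w _ => this w]
  simp

lemma integrable_box {v p : ℕ} (a : Fin v → Fin p) :
    Integrable ((Set.univ.pi fun w => cell p (a w)).indicator (fun _ => (1:ℝ)))
      (Measure.pi fun _ : Fin v => μ01) := 
  (integrable_const (1:ℝ)).indicator (MeasurableSet.univ_pi fun w => cell_meas _)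

lemma integrable_prod_ep {n v p : ℕ} (hp : 0 < p) (s t : Fin n → Fin v)
    (hni : ∀ w, ∃ e, s e = w ∨ t e = w) (s' t' : Fin n → Fin p) (c : Fin n → Fin n) :
    Integrable (fun x : Fin v → ℝ => ∏ e, ep p (s' (c e)) (t' (c e)) (x (s e)) (x (t e)))
      (Measure.pi fun _ : Fin v => μ01) := by
  simp only [prod_ep hp s t hni]
  refine integrable_finsetSum _ fun a _ => ?_
  split_ifs
  · exact integrable_box a
  · exact integrable_zero _ _ _

lemma integral_prod_ep {n v p : ℕ} (hp : 0 < p) (s t : Fin n → Fin v)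
    (hni : ∀ w, ∃ e, s e = w ∨ t e = w) (s' t' : Fin n → Fin p) (c : Fin n → Fin n) :
    ∫ x : Fin v → ℝ, ∏ e, ep p (s' (c e)) (t' (c e)) (x (s e)) (x (t e))
      ∂(Measure.pi fun _ : Fin v => μ01)
    = ∑ a : Fin v → Fin p, if Cpt s t s' t' c a then (1 / p : ℝ) ^ v else 0 := by
  simp only [prod_ep hp s t hni]
  rw [integral_finsetSum]
  · refine Finset.sum_congr rfl fun a _ => ?_
    split_ifs
    · exact integral_box hp a
    · simp
  · intro a _
    split_ifs
    · exact integrable_box a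
    · exact integrable_zero _ _ _

lemma gD_formula (H : MG) (hHni : NoIsolated H) (p : ℕ) (hp : 0 < p)
    (s' t' : Fin H.ne → Fin p) :
    gD Graphons (homDensity H) H.ne 0 (fun l => ep p (s' l) (t' l))
      = ∑ c : Fin H.ne → Fin H.ne, if Function.Surjective c then
          ∑ a : Fin H.nv → Fin p, if Cpt H.s H.t s' t' c a then (1 / p : ℝ) ^ H.nv else 0
        else 0 := by
  set g : Fin H.ne → Kern := fun l => ep p (s' l) (t' l) with hg
  set T : (Fin H.ne → Fin H.ne) → ℝ := fun c =>
    ∑ a : Fin H.nv → Fin p, if Cpt H.s H.t s' t' c a then (1 / p : ℝ) ^ H.nv else 0 with hT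
  set f : (Fin H.ne → ℝ) → Kern := fun lam => ∑ i, lam i • g i with hf
  have key := gD_eq_iterPD Graphons (homDensity H) H.ne g
    (∑ c : Fin H.ne → Fin H.ne, MvPolynomial.C (T c) * ∏ e, MvPolynomial.X (c e))
    {lam | IsGraphon (f lam) ∧ ∃ C < 1, ∀ x y, f lam x y ≤ C} ?_ ?_ ?_ H.ne le_rfl 0 ?_
  · rw [iterPD_full] at key
    have h00 : (∑ i, (0 : Fin H.ne → ℝ) i • g i) = 0 := by simp
    rw [h00] at key
    exact key
  · intro lam _
    have h1 : ∀ x : Fin H.nv → ℝ, ∏ e, (∑ i, lam i • g i) (x (H.s e)) (x (H.t e))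
        = ∑ c : Fin H.ne → Fin H.ne, (∏ e, lam (c e)) *
          ∏ e, ep p (s' (c e)) (t' (c e)) (x (H.s e)) (x (H.t e)) := by
      intro x
      simp only [Finset.sum_apply, Pi.smul_apply, smul_eq_mul]
      rw [Finset.prod_univ_sum, Fintype.piFinset_univ]
      simp only [Finset.prod_mul_distrib, hg]
    unfold homDensity
    simp only [h1]
    rw [integral_finsetSum]
    · simp only [integral_const_mul, integral_prod_ep hp H.s H.t hHni, map_sum, map_mul, map_prod,
        MvPolynomial.eval_C, MvPolynomial.eval_X]
      exact Finset.sum_congr rfl fun c _ => mul_comm _ _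
    · intro c _
      exact (integrable_prod_ep hp H.s H.t hHni s' t' c).const_mul _
  · rintro lam ⟨⟨⟨hm, hs⟩, hb⟩, C, hC, hfC⟩ i
    change (nhdsWithin (0:ℝ) {t : ℝ | t ≠ 0 ∧ f lam + t • g i ∈ Graphons}).NeBot
    have hgi := ep_graphon (s' i) (t' i)
    have hle : nhdsWithin (0:ℝ) (Set.Ioo 0 (1 - C)) ≤
        nhdsWithin (0:ℝ) {t : ℝ | t ≠ 0 ∧ f lam + t • g i ∈ Graphons} := by
      apply nhdsWithin_mono
      intro t ht
      refine ⟨ht.1.ne', ⟨⟨?_, ?_⟩, ?_⟩⟩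
      · exact hm.add (hgi.1.1.const_mul t)
      · intro x y
        simp only [Pi.add_apply, Pi.smul_apply]
        rw [hs x y, hg]
        simp only [hgi.1.2 x y]
      · intro x y
        have h1 := hb x y
        have h2 := hgi.2 x y
        have h3 := hfC x y
        have h4 := ht.1
        have h5 := ht.2
        simp only [Pi.add_apply, Pi.smul_apply, smul_eq_mul, hg]
        constructor
        · nlinarith [h1.1, h2.1, mul_nonneg h4.le h2.1]
        · nlinarith [h1.1, h2.2, mul_le_mul_of_nonneg_left h2.2 h4.le]
    have : (nhdsWithin (0:ℝ) (Set.Ioo 0 (1 - C))).NeBot := by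
      rw [nhdsWithin_Ioo_eq_nhdsGT (by linarith)]
      infer_instance
    exact NeBot.mono this hle
  · rintro lam ⟨-, C, hC, hfC⟩ i
    have e1 : ∀ t : ℝ, f (lam + Pi.single i t) = f lam + t • g i := by
      intro t
      simp only [hf, Pi.add_apply, add_smul, Finset.sum_add_distrib]
      congr 1
      rw [Finset.sum_eq_single i]
      · simp
      · intro b _ hb; simp [hb]
      · simp
    have hsm : ∀ᶠ t in nhdsWithin (0:ℝ) {t : ℝ | t ≠ 0 ∧ (∑ j, lam j • g j) + t • g i ∈ Graphons},
        |t| < (1 - C) / 2 := by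
      apply mem_nhdsWithin_of_mem_nhds
      have := Metric.ball_mem_nhds (0:ℝ) (show 0 < (1 - C) / 2 by linarith)
      filter_upwards [this] with t ht
      simpa using ht
    filter_upwards [hsm, self_mem_nhdsWithin] with t ht hU
    refine ⟨?_, (1 + C) / 2, by linarith, ?_⟩
    · rw [e1]; exact hU.2
    · intro x y
      rw [e1]
      have h2 := (ep_graphon (s' i) (t' i)).2 x y
      have h3 := hfC x y
      simp only [Pi.add_apply, Pi.smul_apply, smul_eq_mul, hg]
      have h4 : t * ep p (s' i) (t' i) x y ≤ |t| := by
        calc t * ep p (s' i) (t' i) x y ≤ |t| * ep p (s' i) (t' i) x y :=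
              mul_le_mul_of_nonneg_right (le_abs_self t) h2.1
          _ ≤ |t| * 1 := mul_le_mul_of_nonneg_left h2.2 (abs_nonneg t)
          _ = |t| := mul_one _
      linarith
  · have : f 0 = 0 := by simp [hf]
    refine ⟨?_, 0, by norm_num, ?_⟩
    · rw [this]
      refine ⟨⟨measurable_const, fun _ _ => rfl⟩, fun _ _ => by simp⟩
    · intro x y; rw [this]; simp

lemma count_formula (H h : MG) (hn : h.ne = H.ne) (p : ℕ) (φ : Fin h.nv ≃ Fin p) :
    (∑ c : Fin H.ne → Fin H.ne, if Function.Surjective c then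
          ∑ a : Fin H.nv → Fin p, if Cpt H.s H.t (fun l => φ (h.s (Fin.cast hn.symm l)))
            (fun l => φ (h.t (Fin.cast hn.symm l))) c a then (1 / p : ℝ) ^ H.nv else 0
        else 0)
    = (Nat.card {ψ : MGHom H h // Function.Surjective ψ.eMap ∧
            ∀ v : Fin h.nv, (∃ e, h.s e = v ∨ h.t e = v) → ∃ u, ψ.vMap u = v} : ℝ)
          / (p : ℝ) ^ H.nv := by
  obtain ⟨hnv, hne, hs, ht, hl⟩ := h
  simp only at hn φ
  subst hn
  simp only [Fin.cast_refl, id]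
  let S := {q : (Fin H.ne → Fin H.ne) × (Fin H.nv → Fin p) // Function.Surjective q.1 ∧
    Cpt H.s H.t (fun l => φ (hs l)) (fun l => φ (ht l)) q.1 q.2}
  have hcard : Nat.card {ψ : MGHom H ⟨hnv, H.ne, hs, ht, hl⟩ // Function.Surjective ψ.eMap ∧
            ∀ v : Fin hnv, (∃ e, hs e = v ∨ ht e = v) → ∃ u, ψ.vMap u = v} = Nat.card S := by
    refine Nat.card_congr ⟨fun ψ => ⟨(ψ.1.eMap, fun u => φ (ψ.1.vMap u)), ψ.2.1, ?_⟩,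
      fun q => ⟨⟨fun u => φ.symm (q.1.2 u), q.1.1, ?_⟩, q.2.1, ?_⟩, ?_, ?_⟩
    · intro e
      have := ψ.1.compat e
      rw [pair_eq] at this ⊢
      simpa using this
    · intro e
      have := q.2.2 e
      rw [pair_eq] at this ⊢
      simpa [Equiv.eq_symm_apply] using this
    · rintro v ⟨e, he⟩
      obtain ⟨e', rfl⟩ := q.2.1 e
      have := q.2.2 e'
      rw [pair_eq] at this
      simp only [Equiv.symm_apply_eq]
      rcases he with rfl | rfl <;> rcases this with ⟨h1, h2⟩ | ⟨h1, h2⟩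
      · exact ⟨_, h1.symm⟩
      · exact ⟨_, h1.symm⟩
      · exact ⟨_, h2.symm⟩
      · exact ⟨_, h2.symm⟩
    · rintro ⟨⟨v, e, h1⟩, h2⟩
      simp
    · rintro ⟨⟨c, a⟩, h2⟩
      simp
  rw [hcard, Nat.card_eq_fintype_card, Fintype.card_subtype, Finset.card_filter]
  push_cast
  rw [Fintype.sum_prod_type, Finset.sum_div]
  refine Finset.sum_congr rfl fun c _ => ?_
  by_cases hc : Function.Surjective c
  · simp only [hc, if_true, true_and]
    rw [Finset.sum_div]
    refine Finset.sum_congr rfl fun a _ => ?_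
    split_ifs <;> simp
  · simp [hc]

end Stmt13Aux

/-- Let `H` be a multigraph with `n` edges and no isolated vertices,
`p ≥ 2`, and `h` a multigraph with `n` edges on `p` vertices.  Fixing a bijection `φ`
of the vertices of `h` with `{1,…,p}` and taking the directions
`g_e := e^p_(φ(e_s), φ(e_t))` for `e ∈ E(h)`, the `n`-th Gâteaux derivative of
`t(H,·)` at `0` in these directions equals `|Surj(H, h̃)| / p^{|V(H)|}`; in particular
it is positive iff `H` surjects onto `h` with its isolated vertices removed. -/
theorem stmt13 (H : MG) (hHni : NoIsolated H) (p : ℕ) (hp : 2 ≤ p)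
    (h : MG) (hv : h.nv = p) (hn : h.ne = H.ne) (φ : Fin h.nv ≃ Fin p) :
    gD Graphons (homDensity H) H.ne 0
        (fun l => ep p (φ (h.s (Fin.cast hn.symm l))) (φ (h.t (Fin.cast hn.symm l))))
      = (Nat.card {ψ : MGHom H h // Function.Surjective ψ.eMap ∧
            ∀ v : Fin h.nv, (∃ e, h.s e = v ∨ h.t e = v) → ∃ u, ψ.vMap u = v} : ℝ)
          / (p : ℝ) ^ H.nv ∧
    (0 < gD Graphons (homDensity H) H.ne 0
        (fun l => ep p (φ (h.s (Fin.cast hn.symm l))) (φ (h.t (Fin.cast hn.symm l)))) ↔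
      Nonempty {ψ : MGHom H h // Function.Surjective ψ.eMap ∧
        ∀ v : Fin h.nv, (∃ e, h.s e = v ∨ h.t e = v) → ∃ u, ψ.vMap u = v}) := by
  have hmain := (gD_formula H hHni p (by omega)
    (fun l => φ (h.s (Fin.cast hn.symm l))) (fun l => φ (h.t (Fin.cast hn.symm l)))).trans
    (count_formula H h hn p φ)
  refine ⟨hmain, ?_⟩
  rw [hmain]
  have hp' : (0:ℝ) < (p:ℝ) ^ H.nv := by
    have : (0:ℝ) < p := by exact_mod_cast (by omega : 0 < p)
    positivity
  rw [div_pos_iff_of_pos_right hp', Nat.cast_pos, Nat.card_pos_iff]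
  exact ⟨fun hh => hh.1, fun hh => ⟨hh, inferInstance⟩⟩
end

section
/- The homomorphism densities t(H,−), as H ranges over all isomorphism classes of multigraphs with no isolated vertices (including the empty graph, with t ≡ 1), are linearly independent as functions on the set W_𝐩 of step graphons, and hence linearly independent as functions on 𝒲. In particular, the t(H,−) for H ranging over isomorphism classes of finite simple graphs with no isolated vertices are linearly independent. -/
open MeasureTheory Filter Set Topology
open scoped BigOperators Classical ENNReal

/-- Index of the cell containing a point of `(0,1]`, for the partition in `n+1` cells. -/
noncomputable def cellIdx (n : ℕ) (x : ℝ) : Fin (n + 1) :=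
  Fin.ofNat (n + 1) (⌈((n + 1 : ℕ) : ℝ) * x⌉₊ - 1)

lemma measurable_cellIdx (n : ℕ) : Measurable (cellIdx n) := by
  have h1 : Measurable (fun k : ℕ => Fin.ofNat (n + 1) (k - 1)) := measurable_from_nat
  exact h1.comp (Nat.measurable_ceil.comp (measurable_const.mul measurable_id))

lemma mem_cell_iff (n : ℕ) (a : Fin (n + 1)) (x : ℝ) :
    x ∈ cell (n + 1) a ↔ ⌈((n + 1 : ℕ) : ℝ) * x⌉₊ = (a : ℕ) + 1 := by
  have hp : (0 : ℝ) < ((n + 1 : ℕ) : ℝ) := by positivity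
  rw [Nat.ceil_eq_iff (Nat.succ_ne_zero _)]
  unfold cell
  rw [Set.mem_Ioc, div_lt_iff₀ hp, le_div_iff₀ hp, mul_comm x]
  simp

lemma cell_unique {n : ℕ} {a b : Fin (n + 1)} {x : ℝ}
    (ha : x ∈ cell (n + 1) a) (hb : x ∈ cell (n + 1) b) : b = a := by
  rw [mem_cell_iff] at ha hb
  exact Fin.ext (by omega)

lemma cellIdx_of_mem {n : ℕ} {a : Fin (n + 1)} {x : ℝ}
    (ha : x ∈ cell (n + 1) a) : cellIdx n x = a := by
  rw [mem_cell_iff] at ha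
  unfold cellIdx
  rw [ha]
  ext
  simp

lemma mem_cell_cellIdx (n : ℕ) {x : ℝ} (hx : x ∈ Set.Ioc (0 : ℝ) 1) :
    x ∈ cell (n + 1) (cellIdx n x) := by
  have hp : (0 : ℝ) < ((n + 1 : ℕ) : ℝ) := by positivity
  have h0 : 0 < ⌈((n + 1 : ℕ) : ℝ) * x⌉₊ := Nat.ceil_pos.2 (mul_pos hp hx.1)
  have h1 : ⌈((n + 1 : ℕ) : ℝ) * x⌉₊ ≤ n + 1 := by
    rw [Nat.ceil_le]
    nlinarith [hx.2]
  have : x ∈ cell (n + 1) ⟨⌈((n + 1 : ℕ) : ℝ) * x⌉₊ - 1, by omega⟩ := by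
    rw [mem_cell_iff]
    simp only
    omega
  rwa [cellIdx_of_mem this]

lemma stepFn_of_mem {n : ℕ} (C : Fin (n + 1) → Fin (n + 1) → ℝ) {a b : Fin (n + 1)} {x y : ℝ}
    (ha : x ∈ cell (n + 1) a) (hb : y ∈ cell (n + 1) b) :
    stepFn (n + 1) C x y = if a = b then 0 else C a b := by
  have hx : ∀ a', x ∈ cell (n + 1) a' ↔ a' = a :=
    fun a' => ⟨fun h => cell_unique ha h, fun h => h ▸ ha⟩
  have hy : ∀ a', y ∈ cell (n + 1) a' ↔ a' = b :=
    fun a' => ⟨fun h => cell_unique hb h, fun h => h ▸ hb⟩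
  unfold stepFn
  simp only [hx, hy]
  rw [Finset.sum_eq_single a, Finset.sum_eq_single b]
  · by_cases h : a = b <;> simp [h]
  · intro b' _ h; simp [h]
  · simp
  · intro a' _ h; simp [h]
  · simp

lemma stepFn_mem {n : ℕ} (X : Sym2 (Fin (n + 1)) → ℝ) (hX : ∀ z, X z ∈ Set.Icc (0 : ℝ) 1) :
    stepFn (n + 1) (fun a b => X s(a, b)) ∈ StepGraphons := by
  refine ⟨⟨⟨?_, ?_⟩, ?_⟩, _, _, rfl⟩
  · unfold stepFn Function.uncurry
    refine Finset.measurable_sum _ fun a _ => Finset.measurable_sum _ fun b _ => ?_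
    refine Measurable.ite ?_ measurable_const measurable_const
    have h1 : MeasurableSet (cell (n + 1) a) := measurableSet_Ioc
    have h2 : MeasurableSet (cell (n + 1) b) := measurableSet_Ioc
    exact (MeasurableSet.const _).inter ((measurable_fst h1).inter (measurable_snd h2))
  · intro x y
    unfold stepFn
    rw [Finset.sum_comm]
    refine Finset.sum_congr rfl fun a _ => Finset.sum_congr rfl fun b _ => ?_
    dsimp only
    rw [Sym2.eq_swap]
    congr 1
    simp only [eq_iff_iff]
    constructor
    · rintro ⟨h1, h2, h3⟩; exact ⟨h1.symm, h3, h2⟩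
    · rintro ⟨h1, h2, h3⟩; exact ⟨h1.symm, h3, h2⟩
  · intro x y
    by_cases hx : ∃ a, x ∈ cell (n + 1) a
    · by_cases hy : ∃ b, y ∈ cell (n + 1) b
      · obtain ⟨a, ha⟩ := hx
        obtain ⟨b, hb⟩ := hy
        rw [stepFn_of_mem _ ha hb]
        split_ifs
        · simp
        · exact hX _
      · push Not at hy
        simp [stepFn, hy]
    · push Not at hx
      simp [stepFn, hx]

/-- The weight of a cell assignment. -/
noncomputable def cellWt (n k : ℕ) (φ : Fin k → Fin (n + 1)) : ℝ :=
  (Measure.pi fun _ : Fin k => μ01.map (cellIdx n)).real {φ}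

instance cellMap_prob (n : ℕ) : IsProbabilityMeasure (μ01.map (cellIdx n)) := by
  have : IsProbabilityMeasure μ01 := ⟨by simp⟩
  exact Measure.isProbabilityMeasure_map (measurable_cellIdx n).aemeasurable

lemma cellWt_pos (n k : ℕ) (φ : Fin k → Fin (n + 1)) : 0 < cellWt n k φ := by
  unfold cellWt
  rw [measureReal_def, ENNReal.toReal_pos_iff]
  refine ⟨?_, measure_lt_top _ _⟩
  rw [Measure.pi_singleton, pos_iff_ne_zero, Finset.prod_ne_zero_iff]
  intro i _
  rw [Measure.map_apply (measurable_cellIdx n) (measurableSet_singleton _),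
    ← pos_iff_ne_zero]
  have hsub : cell (n + 1) (φ i) ⊆ cellIdx n ⁻¹' {φ i} := fun x hx => cellIdx_of_mem hx
  refine lt_of_lt_of_le ?_ (measure_mono hsub)
  have hp : (0 : ℝ) < ((n + 1 : ℕ) : ℝ) := by positivity
  have hsub2 : cell (n + 1) (φ i) ⊆ Set.Icc 0 1 := by
    intro x hx
    refine ⟨le_trans (by positivity) hx.1.le, hx.2.trans ?_⟩
    rw [div_le_one hp]
    exact_mod_cast (φ i).isLt
  have hms : MeasurableSet (cell (n + 1) (φ i)) := measurableSet_Ioc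
  rw [Measure.restrict_apply hms, Set.inter_eq_left.2 hsub2]
  unfold cell
  rw [Real.volume_Ioc, ENNReal.ofReal_pos, ← sub_div]
  rw [add_sub_cancel_left]
  positivity

lemma homDensity_stepFn (G : MG) (n : ℕ) (C : Fin (n + 1) → Fin (n + 1) → ℝ) :
    homDensity G (stepFn (n + 1) C) = ∑ φ : Fin G.nv → Fin (n + 1), cellWt n G.nv φ *
      ∏ e : Fin G.ne, if φ (G.s e) = φ (G.t e) then 0 else C (φ (G.s e)) (φ (G.t e)) := by
  set F : (Fin G.nv → Fin (n + 1)) → ℝ := fun φ =>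
    ∏ e : Fin G.ne, if φ (G.s e) = φ (G.t e) then 0 else C (φ (G.s e)) (φ (G.t e)) with hF
  have hae : ∀ᵐ x ∂(Measure.pi fun _ : Fin G.nv => μ01), ∀ i, x i ∈ Set.Ioc (0 : ℝ) 1 := by
    rw [ae_all_iff]
    intro i
    have h1 : ∀ᵐ y ∂μ01, y ∈ Set.Ioc (0 : ℝ) 1 := by
      rw [show μ01 = volume.restrict (Set.Ioc 0 1) from
        (Measure.restrict_congr_set Ioc_ae_eq_Icc).symm]
      exact ae_restrict_mem measurableSet_Ioc
    exact (Measure.tendsto_eval_ae_ae (μ := fun _ : Fin G.nv => μ01) (i := i)).eventually h1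
  have h2 : homDensity G (stepFn (n + 1) C)
      = ∫ x : Fin G.nv → ℝ, F (fun i => cellIdx n (x i)) ∂(Measure.pi fun _ => μ01) := by
    unfold homDensity
    refine integral_congr_ae ?_
    filter_upwards [hae] with x hx
    refine Finset.prod_congr rfl fun e _ => ?_
    exact stepFn_of_mem C (mem_cell_cellIdx n (hx _)) (mem_cell_cellIdx n (hx _))
  have hm : Measurable (fun (x : Fin G.nv → ℝ) i => cellIdx n (x i)) :=
    measurable_pi_lambda _ fun i => (measurable_cellIdx n).comp (measurable_pi_apply i)
  have h3 : ∫ x : Fin G.nv → ℝ, F (fun i => cellIdx n (x i)) ∂(Measure.pi fun _ => μ01)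
      = ∫ φ, F φ ∂(Measure.pi fun _ : Fin G.nv => μ01.map (cellIdx n)) := by
    rw [← Measure.pi_map_pi (μ := fun _ : Fin G.nv => μ01) (f := fun _ => cellIdx n)
      (fun i => (measurable_cellIdx n).aemeasurable)]
    rw [integral_map hm.aemeasurable (Measurable.of_discrete).aestronglyMeasurable]
  rw [h2, h3, integral_fintype Integrable.of_finite]
  rfl

/-- Edge equivalence from equality of edge monomials. -/
lemma exists_edge_equiv {α ι κ : Type*} [Fintype ι] [Fintype κ] (z : ι → α) (z' : κ → α)
    (h : ∑ e, Finsupp.single (z e) 1 = ∑ e, (Finsupp.single (z' e) 1 : α →₀ ℕ)) :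
    ∃ σ : ι ≃ κ, ∀ e, z' (σ e) = z e := by
  have hc : ∀ w, Nonempty ({e // z e = w} ≃ {e // z' e = w}) := by
    intro w
    rw [← Fintype.card_eq]
    have := DFunLike.congr_fun h w
    simp only [Finsupp.coe_finsetSum, Finset.sum_apply, Finsupp.single_apply] at this
    simpa [Fintype.card_subtype] using this
  let E : ∀ w, {e // z e = w} ≃ {e // z' e = w} := fun w => (hc w).some
  refine ⟨(Equiv.sigmaFiberEquiv z).symm.trans
    ((Equiv.sigmaCongrRight E).trans (Equiv.sigmaFiberEquiv z')), fun e => ?_⟩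
  exact (E (z e) ⟨e, rfl⟩).2

lemma iso_of_monomial {G K : MG} (hK : NoIsolated K) (hle : G.nv ≤ K.nv)
    (φ : Fin G.nv → Fin (K.nv + 1))
    (h : ∑ e, Finsupp.single s(φ (G.s e), φ (G.t e)) 1
      = ∑ e, (Finsupp.single s((K.s e).castSucc, (K.t e).castSucc) 1 :
          Sym2 (Fin (K.nv + 1)) →₀ ℕ)) : MGIso K G := by
  obtain ⟨σ, hσ⟩ := exists_edge_equiv _ _ h.symm
  have hex : ∀ v : Fin K.nv, ∃ u, φ u = v.castSucc := by
    intro v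
    obtain ⟨e, he⟩ := hK v
    have h1 := hσ e
    rw [Sym2.eq_iff] at h1
    rcases he with rfl | rfl <;> rcases h1 with h1 | h1
    · exact ⟨_, h1.1⟩
    · exact ⟨_, h1.2⟩
    · exact ⟨_, h1.2⟩
    · exact ⟨_, h1.1⟩
  choose ψ hψ using hex
  have hinj : Function.Injective ψ := by
    intro a b hab
    have := hψ a
    rw [hab, hψ b] at this
    exact (Fin.castSucc_injective _ this).symm
  have hcard : G.nv = K.nv := le_antisymm hle (by simpa using Fintype.card_le_of_injective ψ hinj)
  have hbij : Function.Bijective ψ := by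
    rw [Fintype.bijective_iff_injective_and_card]
    exact ⟨hinj, by simp [hcard]⟩
  have hφ : Function.Injective φ := by
    intro a b hab
    obtain ⟨a, rfl⟩ := hbij.2 a
    obtain ⟨b, rfl⟩ := hbij.2 b
    rw [hψ, hψ] at hab
    rw [Fin.castSucc_injective _ hab]
  refine ⟨⟨ψ, σ, fun e => ?_⟩, hbij, σ.bijective⟩
  have h1 := hσ e
  rw [← hψ, ← hψ, Sym2.eq_iff] at h1
  rcases h1 with ⟨h1, h2⟩ | ⟨h1, h2⟩
  · rw [hφ h1, hφ h2]
  · rw [hφ h1, hφ h2, Finset.pair_comm]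

/-- The polynomial attached to an assignment. -/
noncomputable def asgPoly (G : MG) (n : ℕ) (φ : Fin G.nv → Fin (n + 1)) :
    MvPolynomial (Sym2 (Fin (n + 1))) ℝ :=
  if ∃ e, φ (G.s e) = φ (G.t e) then 0 else
    MvPolynomial.monomial (∑ e, Finsupp.single s(φ (G.s e), φ (G.t e)) 1) 1

lemma eval_asgPoly (G : MG) (n : ℕ) (φ : Fin G.nv → Fin (n + 1))
    (X : Sym2 (Fin (n + 1)) → ℝ) :
    MvPolynomial.eval X (asgPoly G n φ) = ∏ e : Fin G.ne,
      if φ (G.s e) = φ (G.t e) then 0 else X s(φ (G.s e), φ (G.t e)) := by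
  unfold asgPoly
  split_ifs with h
  · obtain ⟨e, he⟩ := h
    rw [map_zero, Finset.prod_eq_zero (Finset.mem_univ e) (by simp [he])]
  · push Not at h
    rw [MvPolynomial.monomial_sum_one, map_prod]
    refine Finset.prod_congr rfl fun e _ => ?_
    rw [if_neg (h e), MvPolynomial.eval_monomial]
    simp

lemma coeff_asgPoly_nonneg (G : MG) (n : ℕ) (φ : Fin G.nv → Fin (n + 1)) (d) :
    0 ≤ MvPolynomial.coeff d (asgPoly G n φ) := by
  unfold asgPoly
  split_ifs with h
  · simp
  · rw [MvPolynomial.coeff_monomial]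
    split_ifs <;> simp

lemma coeff_asgPoly_ne (G : MG) (n : ℕ) (φ : Fin G.nv → Fin (n + 1)) (d)
    (h : MvPolynomial.coeff d (asgPoly G n φ) ≠ 0) :
    ∑ e, Finsupp.single s(φ (G.s e), φ (G.t e)) 1 = d := by
  unfold asgPoly at h
  split_ifs at h with h'
  · simp at h
  · rw [MvPolynomial.coeff_monomial] at h
    by_contra hne
    simp [hne] at h


/-- Linear independence of multigraph homomorphism densities. Any
finite linear combination of homomorphism densities of pairwise non-isomorphic
multigraphs without isolated vertices which vanishes on all step graphons has all its
coefficients equal to zero (so the `t(H,·)` are linearly independent on `W_𝐩`, hence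
on `𝒲`; in particular this holds for simple graphs). -/
theorem stmt14 (m : ℕ) (H : Fin m → MG) (c : Fin m → ℝ)
    (hni : ∀ i, NoIsolated (H i))
    (hpair : ∀ i j, i ≠ j → ¬ MGIso (H i) (H j))
    (hvanish : ∀ f ∈ StepGraphons, ∑ i, c i * homDensity (H i) f = 0) :
    ∀ i, c i = 0 := by
  by_contra hcon
  push Not at hcon
  obtain ⟨j, hj, hmax⟩ : ∃ j, c j ≠ 0 ∧ ∀ i, c i ≠ 0 → (H i).nv ≤ (H j).nv := by
    obtain ⟨i0, hi0⟩ := hcon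
    obtain ⟨j, hj, hjm⟩ := (Finset.univ.filter fun i => c i ≠ 0).exists_max_image
      (fun i => (H i).nv) ⟨i0, by simpa using hi0⟩
    exact ⟨j, by simpa using hj, fun i hi => hjm i (by simpa using hi)⟩
  set n := (H j).nv with hn
  let P : MvPolynomial (Sym2 (Fin (n + 1))) ℝ :=
    ∑ i, MvPolynomial.C (c i) * ∑ φ : Fin (H i).nv → Fin (n + 1),
      MvPolynomial.C (cellWt n (H i).nv φ) * asgPoly (H i) n φ
  have hP : P = 0 := by
    refine MvPolynomial.funext_set (fun _ => Set.Icc (0 : ℝ) 1)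
      (fun _ => Set.Icc_infinite one_pos) fun X hX => ?_
    have h1 := hvanish _ (stepFn_mem X fun z => hX z (Set.mem_univ z))
    rw [map_zero, ← h1]
    simp only [P, map_sum, map_mul, MvPolynomial.eval_C, eval_asgPoly, homDensity_stepFn]
  let d : Sym2 (Fin (n + 1)) →₀ ℕ :=
    ∑ e, Finsupp.single s(((H j).s e).castSucc, ((H j).t e).castSucc) 1
  have hco : ∑ i, c i * ∑ φ : Fin (H i).nv → Fin (n + 1),
      cellWt n (H i).nv φ * MvPolynomial.coeff d (asgPoly (H i) n φ) = 0 := by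
    have h1 : MvPolynomial.coeff d P = 0 := by rw [hP]; simp
    rw [← h1]
    simp only [P, MvPolynomial.coeff_sum, MvPolynomial.coeff_C_mul]
  rw [Finset.sum_eq_single j] at hco
  · have hpos : 0 < ∑ φ : Fin (H j).nv → Fin (n + 1),
        cellWt n (H j).nv φ * MvPolynomial.coeff d (asgPoly (H j) n φ) := by
      refine Finset.sum_pos' (fun φ _ => mul_nonneg (cellWt_pos _ _ _).le
        (coeff_asgPoly_nonneg _ _ _ _)) ⟨Fin.castSucc, Finset.mem_univ _, ?_⟩
      refine mul_pos (cellWt_pos _ _ _) ?_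
      have hnl : ¬ ∃ e, ((H j).s e).castSucc = ((H j).t e).castSucc := by
        rintro ⟨e, he⟩
        exact (H j).noLoop e (Fin.castSucc_injective _ he)
      unfold asgPoly
      rw [if_neg hnl, MvPolynomial.coeff_monomial, if_pos rfl]
      exact one_pos
    rcases mul_eq_zero.1 hco with h | h
    · exact hj h
    · exact hpos.ne' h
  · intro i _ hij
    by_cases hci : c i = 0
    · simp [hci]
    · rw [Finset.sum_eq_zero, mul_zero]
      intro φ _
      by_contra hne
      have h2 := coeff_asgPoly_ne _ _ _ _ (right_ne_zero_of_mul hne)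
      exact hpair j i hij.symm (iso_of_monomial (hni j) (hmax i hci) φ h2)
  · simp
end
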